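/- Let d ∈ ℕ, τ ≥ d+1, and n ≥ τ⁴. Then uniformly for k ∈ B_{n,p} and p ∈ P_τ one has log( P_{n,p}(k) / ( n^{−d/2} φ_{Σ_p}(δ_{k,p}) ) ) = n^{−1/2} Σ_{i=1}^{d+1} ( δ_{k_i,p_i}³/(6 p_i²) − δ_{k_i,p_i}/(2 p_i) ) + R_{n,p}(k), where the error satisfies |R_{n,p}(k)| ≤ n^{−1} Σ_{i=1}^{d+1} ( 21 |δ_{k_i,p_i}|⁴/p_i³ + 10 |δ_{k_i,p_i}|²/p_i² + 2τ/3 ). -/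

import Mathlib

open MeasureTheory Matrix Real Finset
open scoped BigOperators ENNReal NNReal

noncomputable section

/-- Extended probability vector: `p` on `Fin d`, together with `p (d+1) = 1 - ∑ p`. -/
def extP (d : ℕ) (p : Fin d → ℝ) : Fin (d + 1) → ℝ :=
  Fin.snoc p (1 - ∑ i, p i)

/-- Extended coordinate vector: `v` on `Fin d`, together with `v (d+1) = n - ∑ v`. -/
def extV (d n : ℕ) (v : Fin d → ℝ) : Fin (d + 1) → ℝ :=
  Fin.snoc v ((n : ℝ) - ∑ i, v i)

/-- `δ_{y,q} = (y - n q) / √n`. -/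
def del (n : ℕ) (q y : ℝ) : ℝ := (y - n * q) / Real.sqrt n

/-- The vector `δ_{v,p}`. -/
def delVec (d n : ℕ) (p v : Fin d → ℝ) : Fin d → ℝ := fun i => del n (p i) (v i)

/-- The covariance matrix `Σ_p = diag p - p pᵀ`. -/
def covM (d : ℕ) (p : Fin d → ℝ) : Matrix (Fin d) (Fin d) ℝ :=
  Matrix.diagonal p - Matrix.vecMulVec p p

/-- The quadratic form `x ↦ xᵀ Σ_p⁻¹ x`. -/
def quadForm (d : ℕ) (p x : Fin d → ℝ) : ℝ := x ⬝ᵥ ((covM d p)⁻¹ *ᵥ x)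

/-- The Gaussian density `φ_{Σ_p}`. -/
def gaussDens (d : ℕ) (p y : Fin d → ℝ) : ℝ :=
  Real.exp (-(1 / 2) * quadForm d p y) /
    Real.sqrt ((2 * Real.pi) ^ d * ∏ i, extP d p i)

/-- The `Multinomial(n, p)` probability mass function. -/
def multinomialPMF (d n : ℕ) (p : Fin d → ℝ) (k : Fin d → ℕ) : ℝ :=
  if ∑ i, k i ≤ n then
    ((n.factorial : ℝ) / ((∏ i, ((k i).factorial : ℝ)) * ((n - ∑ i, k i).factorial : ℝ))) *
      ((∏ i, p i ^ k i) * (1 - ∑ i, p i) ^ (n - ∑ i, k i))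
  else 0

/-- The interior `S_d^o` of the unit simplex. -/
def simplexInt (d : ℕ) : Set (Fin d → ℝ) :=
  {s | (∀ i, s i ∈ Set.Ioo (0 : ℝ) 1) ∧ ∑ i, s i < 1}

/-- The set `P_τ`. -/
def Ptau (d : ℕ) (τ : ℝ) : Set (Fin d → ℝ) :=
  {s | s ∈ simplexInt d ∧ ∀ i : Fin (d + 1), (extP d s i)⁻¹ ≤ τ}

/-- Cast a vector of naturals to a real vector. -/
def castK (d : ℕ) (k : Fin d → ℕ) : Fin d → ℝ := fun i => (k i : ℝ)

/-- The bulk set `B_{n,p}` (integer vectors). -/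
def bulk (d n : ℕ) (τ : ℝ) (p : Fin d → ℝ) : Set (Fin d → ℕ) :=
  {k | (∀ i, 0 < k i) ∧ ∑ i, k i < n ∧
    ∀ i : Fin (d + 1),
      |del n (extP d p i) (extV d n (castK d k) i) / (Real.sqrt n * extP d p i)| ≤
        τ * Real.sqrt (Real.log n / n)}

/-- The bulk set `B_{n,p}` (real vectors). -/
def bulkReal (d n : ℕ) (τ : ℝ) (p : Fin d → ℝ) : Set (Fin d → ℝ) :=
  {x | ∀ i : Fin (d + 1),
    |del n (extP d p i) (extV d n x i) / (Real.sqrt n * extP d p i)| ≤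
      τ * Real.sqrt (Real.log n / n)}

/-- The main term in the local expansion. -/
def mainTerm (d n : ℕ) (p v : Fin d → ℝ) : ℝ :=
  (n : ℝ) ^ (-(1 : ℝ) / 2) * ∑ i : Fin (d + 1),
    (del n (extP d p i) (extV d n v i) ^ 3 / (6 * extP d p i ^ 2) -
      del n (extP d p i) (extV d n v i) / (2 * extP d p i))

/-- The bound on the remainder `R_{n,p}(k)`. -/
def errBound (d n : ℕ) (τ : ℝ) (p v : Fin d → ℝ) : ℝ :=
  (n : ℝ)⁻¹ * ∑ i : Fin (d + 1),
    (21 * |del n (extP d p i) (extV d n v i)| ^ 4 / extP d p i ^ 3 +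
      10 * |del n (extP d p i) (extV d n v i)| ^ 2 / extP d p i ^ 2 + 2 * τ / 3)

/-- The log-ratio of the multinomial pmf over the corresponding normal density. -/
def logRatio (d n : ℕ) (p : Fin d → ℝ) (k : Fin d → ℕ) : ℝ :=
  Real.log (multinomialPMF d n p k /
    ((n : ℝ) ^ (-(d : ℝ) / 2) * gaussDens d p (delVec d n p (castK d k))))

/-- The law of a `Multinomial(n,p)` random vector, as a measure on `ℝ^d`. -/
def multinomialLaw (d n : ℕ) (p : Fin d → ℝ) : Measure (Fin d → ℝ) :=
  Measure.sum fun k : Fin d → ℕ =>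
    ENNReal.ofReal (multinomialPMF d n p k) • Measure.dirac (castK d k)

/-- The law of a `Uniform(-1/2,1/2)^d` random vector. -/
def uniformBoxLaw (d : ℕ) : Measure (Fin d → ℝ) :=
  volume.restrict (Set.univ.pi fun _ : Fin d => Set.Ioo (-(1 : ℝ) / 2) (1 / 2))

/-- The law of a `Normal_d (n p, n Σ_p)` random vector. -/
def gaussLaw (d n : ℕ) (p : Fin d → ℝ) : Measure (Fin d → ℝ) :=
  volume.withDensity fun y =>
    ENNReal.ofReal ((n : ℝ) ^ (-(d : ℝ) / 2) * gaussDens d p (delVec d n p y))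

/-- The regularized lower incomplete gamma function `γ̄(x, a)`. -/
def regGamma (x a : ℝ) : ℝ :=
  (∫ t in (0 : ℝ)..a, t ^ (x - 1) * Real.exp (-t)) / Real.Gamma x

/-- The upper half of Robbins' form of Stirling's formula. -/
theorem log_factorial_le_stirling {m : ℕ} (hm : m ≠ 0) :
    Real.log m.factorial ≤
      m * Real.log m - m + Real.log m / 2 + Real.log (2 * π) / 2 + 1 / (12 * m) := by
  obtain ⟨j, rfl⟩ := Nat.exists_eq_succ_of_ne_zero hm
  have hmono : Monotone fun i : ℕ =>
      Real.log (Stirling.stirlingSeq (i + 1)) - 1 / (12 * ((i + 1 : ℕ) : ℝ)) := by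
    refine monotone_nat_of_le_succ fun i => ?_
    have h := Stirling.log_stirlingSeq_sdiff_le (i + 1)
    have e : 1 / (12 * ((i + 1 : ℕ) : ℝ)) - 1 / (12 * ((i + 1 + 1 : ℕ) : ℝ)) =
        1 / (12 * ((i + 1 : ℕ) : ℝ) * (((i + 1 : ℕ) : ℝ) + 1)) := by
      push_cast
      field_simp
      ring
    linarith
  have hlim : Filter.Tendsto (fun i : ℕ =>
      Real.log (Stirling.stirlingSeq (i + 1)) - 1 / (12 * ((i + 1 : ℕ) : ℝ)))
      Filter.atTop (nhds (Real.log √π - 0)) := by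
    refine Filter.Tendsto.sub ?_ ?_
    · exact (Stirling.tendsto_stirlingSeq_sqrt_pi.comp
        (Filter.tendsto_add_atTop_nat 1)).log (by positivity)
    · have h := (tendsto_one_div_add_atTop_nhds_zero_nat (𝕜 := ℝ)).const_mul (1 / 12)
      rw [mul_zero] at h
      refine h.congr fun i => ?_
      push_cast
      field_simp
  have h := hmono.ge_of_tendsto hlim j
  have hpos : (0 : ℝ) < ((j + 1 : ℕ) : ℝ) := by positivity
  simp only [Stirling.log_stirlingSeq_formula] at h
  rw [Real.log_sqrt pi_pos.le, Real.log_mul two_ne_zero hpos.ne',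
    Real.log_div hpos.ne' (Real.exp_ne_zero 1), Real.log_exp] at h
  rw [Real.log_mul two_ne_zero pi_ne_zero]
  simp only [Nat.succ_eq_add_one]
  linarith

/-- The first-order expansion of the logarithm at `1`. -/
theorem abs_log_one_add_sub_le {x : ℝ} (hx : |x| ≤ 7 / 8) :
    |Real.log (1 + x) - x| ≤ 8 * x ^ 2 := by
  have h := abs_log_sub_add_sum_range_le (x := -x) (by rw [abs_neg]; linarith) 1
  rw [abs_neg, sub_neg_eq_add] at h
  simp only [Finset.sum_range_one, zero_add, pow_one, Nat.cast_zero, div_one,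
    one_add_one_eq_two, sq_abs] at h
  have h' : x ^ 2 / (1 - |x|) ≤ 8 * x ^ 2 := by
    rw [div_le_iff₀ (by linarith)]
    nlinarith [sq_nonneg x]
  rw [show Real.log (1 + x) - x = -x + Real.log (1 + x) by ring]
  exact h.trans h'

/-- The third-order expansion of the logarithm at `1`. -/
theorem abs_log_one_add_sub_cubic_le {x : ℝ} (hx : |x| ≤ 7 / 8) :
    |Real.log (1 + x) - (x - x ^ 2 / 2 + x ^ 3 / 3)| ≤ 8 * x ^ 4 := by
  have h := abs_log_sub_add_sum_range_le (x := -x) (by rw [abs_neg]; linarith) 3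
  rw [abs_neg, sub_neg_eq_add] at h
  simp only [Finset.sum_range_succ, Finset.sum_range_zero] at h
  norm_num at h
  have hx4 : |x| ^ 4 = x ^ 4 := by rw [← abs_pow, abs_of_nonneg (by positivity)]
  rw [hx4] at h
  have h' : x ^ 4 / (1 - |x|) ≤ 8 * x ^ 4 := by
    rw [div_le_iff₀ (by linarith)]
    nlinarith [pow_nonneg (sq_nonneg x) 2]
  rw [show Real.log (1 + x) - (x - x ^ 2 / 2 + x ^ 3 / 3) =
    -x + x ^ 2 / 2 + (-x) ^ 3 / 3 + Real.log (1 + x) by ring]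
  exact h.trans h'

/-- The contribution of a single cell to the local expansion; here `s = √n` and `x` is the
relative deviation of the cell count from its mean `s ^ 2 * q`. -/
theorem abs_cell_remainder_le {s q x : ℝ} (hs : 0 < s) (hq : 0 < q) (hx : |x| ≤ 7 / 8) :
    |-(s ^ 2 * q * (1 + x) + 1 / 2) * Real.log (1 + x) + s ^ 2 * q * x +
        (s * q * x) ^ 2 / (2 * q) -
        s⁻¹ * ((s * q * x) ^ 3 / (6 * q ^ 2) - s * q * x / (2 * q))| ≤
      (s ^ 2)⁻¹ * (21 * |s * q * x| ^ 4 / q ^ 3 + 10 * |s * q * x| ^ 2 / q ^ 2) := by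
  have h1 := abs_le.1 (abs_log_one_add_sub_le hx)
  have h3 := abs_le.1 (abs_log_one_add_sub_cubic_le hx)
  have hx' := abs_le.1 hx
  have hrhs : (s ^ 2)⁻¹ * (21 * |s * q * x| ^ 4 / q ^ 3 + 10 * |s * q * x| ^ 2 / q ^ 2) =
      s ^ 2 * q * (21 * x ^ 4) + 10 * x ^ 2 := by
    rw [sq_abs, show |s * q * x| ^ 4 = (s * q * x) ^ 4 by
      rw [← abs_pow, abs_of_nonneg (by positivity)]]
    field_simp
  have hlhs : -(s ^ 2 * q * (1 + x) + 1 / 2) * Real.log (1 + x) + s ^ 2 * q * x +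
        (s * q * x) ^ 2 / (2 * q) -
        s⁻¹ * ((s * q * x) ^ 3 / (6 * q ^ 2) - s * q * x / (2 * q)) =
      -(s ^ 2 * q * ((1 + x) * (Real.log (1 + x) - (x - x ^ 2 / 2 + x ^ 3 / 3)) + x ^ 4 / 3)) -
        (Real.log (1 + x) - x) / 2 := by
    field_simp
    ring
  rw [hrhs, hlhs]
  set e := Real.log (1 + x) - (x - x ^ 2 / 2 + x ^ 3 / 3)
  have hx4 : 0 ≤ x ^ 4 := by positivity
  have he : |(1 + x) * e + x ^ 4 / 3| ≤ 21 * x ^ 4 := by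
    rw [abs_le]
    constructor <;> nlinarith [h3.1, h3.2]
  have he' := abs_le.1 he
  have hsq : 0 < s ^ 2 * q := by positivity
  have hu := mul_le_mul_of_nonneg_left he'.1 hsq.le
  have hv := mul_le_mul_of_nonneg_left he'.2 hsq.le
  rw [abs_le]
  constructor <;> nlinarith [h1.1, h1.2, sq_nonneg x]

/-- For `n ≥ τ ^ 4`, points of the bulk have relative deviations at most `7 / 8`. -/
theorem mul_sqrt_log_div_le {τ : ℝ} (hτ : 1 ≤ τ) {n : ℕ} (hn : τ ^ 4 ≤ (n : ℝ)) :
    τ * √(Real.log n / n) ≤ 7 / 8 := by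
  have hn1 : (1 : ℝ) ≤ n := (one_le_pow₀ hτ).trans hn
  have hs : 0 < √(n : ℝ) := Real.sqrt_pos.2 (by linarith)
  have hss : √(n : ℝ) ^ 2 = n := Real.sq_sqrt (by linarith)
  have hτs : τ ^ 2 ≤ √(n : ℝ) := by
    refine Real.le_sqrt_of_sq_le ?_
    rw [← pow_mul]
    exact hn
  have hlog : Real.log √(n : ℝ) ≤ √(n : ℝ) * (49 / 128) := by
    have h := Real.log_le_sub_one_of_pos (x := √(n : ℝ) / Real.exp 1) (by positivity)
    rw [Real.log_div hs.ne' (Real.exp_ne_zero 1), Real.log_exp] at h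
    have he : √(n : ℝ) / Real.exp 1 ≤ √(n : ℝ) * (49 / 128) := by
      rw [div_le_iff₀ (Real.exp_pos 1)]
      nlinarith [Real.exp_one_gt_d9]
    linarith
  have hlog2 : Real.log n = 2 * Real.log √(n : ℝ) := by
    rw [Real.log_sqrt (by linarith)]
    ring
  have hle : Real.log n / n ≤ (7 / 8 / τ) ^ 2 := by
    rw [div_pow, div_le_div_iff₀ (by linarith) (by positivity)]
    have hl0 : 0 ≤ Real.log n := Real.log_nonneg hn1
    nlinarith [mul_le_mul_of_nonneg_left hτs hl0]
  have h := Real.sqrt_le_sqrt hle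
  rw [Real.sqrt_sq (by positivity)] at h
  calc τ * √(Real.log n / n) ≤ τ * (7 / 8 / τ) := by gcongr
    _ = 7 / 8 := by field_simp

theorem sum_extP (d : ℕ) (p : Fin d → ℝ) : ∑ i, extP d p i = 1 := by
  simp [Fin.sum_univ_castSucc, extP]

theorem extP_pos {d : ℕ} {p : Fin d → ℝ} (hp : p ∈ simplexInt d) (i : Fin (d + 1)) :
    0 < extP d p i := by
  induction i using Fin.lastCases with
  | last => simpa [extP] using hp.2
  | cast i => simpa [extP] using (hp.1 i).1

/-- The quadratic form of `Σ_p⁻¹` is a weighted sum of squares of the extended coordinates. -/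
theorem quadForm_eq {d : ℕ} {p : Fin d → ℝ} (hp : p ∈ simplexInt d) (x : Fin d → ℝ) :
    quadForm d p x = ∑ i, x i ^ 2 / p i + (∑ i, x i) ^ 2 / (1 - ∑ i, p i) := by
  have hq : 1 - ∑ i, p i ≠ 0 := (sub_pos.2 hp.2).ne'
  have hpi : ∀ i, p i ≠ 0 := fun i => (hp.1 i).1.ne'
  have hinv : (covM d p)⁻¹ =
      Matrix.diagonal (fun i => (p i)⁻¹) + Matrix.vecMulVec 1 (fun _ => (1 - ∑ i, p i)⁻¹) := by
    refine Matrix.inv_eq_right_inv ?_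
    ext i j
    rw [covM, Matrix.sub_mul, Matrix.mul_add, Matrix.mul_add, Matrix.diagonal_mul_diagonal,
      Matrix.vecMulVec_mul_vecMulVec]
    simp only [Matrix.sub_apply, Matrix.add_apply, Matrix.diagonal_mul, Matrix.mul_diagonal,
      Matrix.vecMulVec_apply, Matrix.diagonal_apply, Matrix.one_apply, dotProduct_one,
      Pi.one_apply, Pi.smul_apply, smul_eq_mul, mul_inv_cancel₀ (hpi _),
      mul_inv_cancel_right₀ (hpi _)]
    split_ifs <;> field_simp <;> ring
  rw [quadForm, hinv, Matrix.add_mulVec, dotProduct_add, Matrix.vecMulVec_mulVec]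
  congr 1
  · simp only [dotProduct, Matrix.mulVec_diagonal]
    refine Finset.sum_congr rfl fun i _ => ?_
    ring
  · simp only [dotProduct, Pi.smul_apply, Pi.one_apply, MulOpposite.smul_eq_mul_unop,
      MulOpposite.unop_op, one_mul]
    rw [← Finset.sum_mul, ← Finset.mul_sum]
    ring

theorem quadForm_delVec {d n : ℕ} {p : Fin d → ℝ} (hp : p ∈ simplexInt d) (v : Fin d → ℝ) :
    quadForm d p (delVec d n p v) =
      ∑ i, del n (extP d p i) (extV d n v i) ^ 2 / extP d p i := by
  rw [quadForm_eq hp, Fin.sum_univ_castSucc]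
  have hsum : ∑ i, delVec d n p v i =
      -del n (1 - ∑ i, p i) ((n : ℝ) - ∑ i, v i) := by
    simp only [delVec, del]
    rw [← Finset.sum_div, Finset.sum_sub_distrib, ← Finset.mul_sum]
    ring
  rw [hsum, neg_sq]
  simp [extP, extV, delVec]

/-- The multinomial mass function in terms of all `d + 1` cells. -/
theorem multinomialPMF_eq {d n : ℕ} (p : Fin d → ℝ) {k : Fin d → ℕ} (hk : ∑ i, k i ≤ n) :
    multinomialPMF d n p k =
      n.factorial / (∏ i, (((Fin.snoc k (n - ∑ i, k i) : Fin (d + 1) → ℕ) i).factorial : ℝ)) *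
        ∏ i, extP d p i ^ (Fin.snoc k (n - ∑ i, k i) : Fin (d + 1) → ℕ) i := by
  simp [multinomialPMF, hk, Fin.prod_univ_castSucc, extP]

theorem cast_snoc_eq_extV {d n : ℕ} {k : Fin d → ℕ} (hk : ∑ i, k i ≤ n) (i : Fin (d + 1)) :
    (((Fin.snoc k (n - ∑ i, k i) : Fin (d + 1) → ℕ) i : ℕ) : ℝ) = extV d n (castK d k) i := by
  induction i using Fin.lastCases with
  | last => simp [extV, castK, Nat.cast_sub hk]
  | cast i => simp [extV, castK]

theorem log_gaussDens {d n : ℕ} (hn : 0 < n) {p : Fin d → ℝ} (hp : p ∈ simplexInt d)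
    (v : Fin d → ℝ) :
    Real.log ((n : ℝ) ^ (-(d : ℝ) / 2) * gaussDens d p (delVec d n p v)) =
      -(d : ℝ) / 2 * Real.log n -
        (∑ i, del n (extP d p i) (extV d n v i) ^ 2 / (2 * extP d p i)) -
        (d : ℝ) / 2 * Real.log (2 * π) - (∑ i, Real.log (extP d p i)) / 2 := by
  have hn' : (0 : ℝ) < n := by exact_mod_cast hn
  have hprod : 0 < ∏ i, extP d p i := Finset.prod_pos fun i _ => extP_pos hp i
  have hpow : (0 : ℝ) < (2 * π) ^ d := by positivity
  rw [Real.log_mul (by positivity) (by unfold gaussDens; positivity), Real.log_rpow hn',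
    gaussDens, Real.log_div (Real.exp_ne_zero _) (by positivity), Real.log_exp,
    Real.log_sqrt (by positivity), Real.log_mul hpow.ne' hprod.ne', Real.log_pow,
    Real.log_prod (fun i _ => (extP_pos hp i).ne'), quadForm_delVec hp]
  have : ∑ i, del n (extP d p i) (extV d n v i) ^ 2 / (2 * extP d p i) =
      1 / 2 * ∑ i, del n (extP d p i) (extV d n v i) ^ 2 / extP d p i := by
    rw [Finset.mul_sum]
    refine Finset.sum_congr rfl fun i _ => ?_
    field_simp
  rw [this]
  ring

/-- The error term in Stirling's formula. -/
def stirlingError (m : ℕ) : ℝ :=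
  Real.log m.factorial -
    (m * Real.log m - m + Real.log m / 2 + Real.log (2 * π) / 2)

theorem stirlingError_nonneg {m : ℕ} (hm : m ≠ 0) : 0 ≤ stirlingError m :=
  sub_nonneg.2 (Stirling.le_log_factorial_stirling hm)

theorem stirlingError_le {m : ℕ} (hm : m ≠ 0) : stirlingError m ≤ 1 / (12 * m) :=
  sub_le_iff_le_add'.2 (log_factorial_le_stirling hm)

/-- The exact form of the log-ratio, with the Stirling errors made explicit. -/
theorem logRatio_eq {d n : ℕ} {p : Fin d → ℝ} (hp : p ∈ simplexInt d) {k : Fin d → ℕ}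
    (hk : ∑ i, k i ≤ n) {K : Fin (d + 1) → ℕ} (hK : K = Fin.snoc k (n - ∑ i, k i))
    (hpos : ∀ i, 0 < K i) (hn : 0 < n) :
    logRatio d n p k =
      (∑ i, (-((K i : ℝ) + 1 / 2) * Real.log (K i / (n * extP d p i)) + (K i - n * extP d p i) +
        del n (extP d p i) (K i) ^ 2 / (2 * extP d p i))) +
      (stirlingError n - ∑ i, stirlingError (K i)) := by
  have hn' : (0 : ℝ) < n := by exact_mod_cast hn
  have hext : ∀ i, (K i : ℝ) = extV d n (castK d k) i := fun i => by
    rw [hK, cast_snoc_eq_extV hk]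
  have hsumK : ∑ i, (K i : ℝ) = n := by
    simp only [hext]
    simp [Fin.sum_univ_castSucc, extV]
  have hfac : ∏ i, ((K i).factorial : ℝ) ≠ 0 :=
    Finset.prod_ne_zero_iff.2 fun i _ => by positivity
  have hqpow : ∏ i, extP d p i ^ K i ≠ 0 :=
    Finset.prod_ne_zero_iff.2 fun i _ => pow_ne_zero _ (extP_pos hp i).ne'
  have hpmf : Real.log (multinomialPMF d n p k) =
      Real.log n.factorial - ∑ i, Real.log (K i).factorial +
        ∑ i, (K i : ℝ) * Real.log (extP d p i) := by
    rw [multinomialPMF_eq p hk, ← hK, Real.log_mul (div_ne_zero (by positivity) hfac) hqpow,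
      Real.log_div (by positivity) hfac, Real.log_prod (fun i _ => by positivity),
      Real.log_prod (fun i _ => pow_ne_zero _ (extP_pos hp i).ne')]
    simp only [Real.log_pow]
  have hpmf0 : multinomialPMF d n p k ≠ 0 := by
    rw [multinomialPMF_eq p hk, ← hK]
    exact mul_ne_zero (div_ne_zero (by positivity) hfac) hqpow
  have hg0 : (n : ℝ) ^ (-(d : ℝ) / 2) * gaussDens d p (delVec d n p (castK d k)) ≠ 0 := by
    have hprod : 0 < ∏ i, extP d p i := Finset.prod_pos fun i _ => extP_pos hp i
    unfold gaussDens
    positivity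
  rw [logRatio, Real.log_div hpmf0 hg0, hpmf, log_gaussDens hn hp]
  simp only [← hext]
  have hcell : ∀ i, -((K i : ℝ) + 1 / 2) * Real.log (K i / (n * extP d p i)) +
        (K i - n * extP d p i) + del n (extP d p i) (K i) ^ 2 / (2 * extP d p i) -
        stirlingError (K i) =
      -Real.log (K i).factorial + K i * Real.log (extP d p i) +
        del n (extP d p i) (K i) ^ 2 / (2 * extP d p i) + Real.log (extP d p i) / 2 +
        K i * Real.log n + (Real.log n / 2 + Real.log (2 * π) / 2) - n * extP d p i := by
    intro i
    have hKi : (0 : ℝ) < K i := by exact_mod_cast hpos i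
    rw [Real.log_div hKi.ne' (mul_pos hn' (extP_pos hp i)).ne',
      Real.log_mul hn'.ne' (extP_pos hp i).ne', stirlingError]
    ring
  have hsum : (∑ i, (-((K i : ℝ) + 1 / 2) * Real.log (K i / (n * extP d p i)) +
        (K i - n * extP d p i) + del n (extP d p i) (K i) ^ 2 / (2 * extP d p i))) -
        ∑ i, stirlingError (K i) =
      -(∑ i, Real.log (K i).factorial) + ∑ i, K i * Real.log (extP d p i) +
        ∑ i, del n (extP d p i) (K i) ^ 2 / (2 * extP d p i) +
        (∑ i, Real.log (extP d p i)) / 2 + n * Real.log n +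
        (d + 1) * (Real.log n / 2 + Real.log (2 * π) / 2) - n := by
    rw [← Finset.sum_sub_distrib, Finset.sum_congr rfl fun i _ => hcell i]
    simp only [Finset.sum_add_distrib, Finset.sum_sub_distrib, Finset.sum_neg_distrib,
      ← Finset.sum_div, ← Finset.sum_mul, ← Finset.mul_sum, hsumK, sum_extP, Finset.sum_const,
      Finset.card_univ, Fintype.card_fin, nsmul_eq_mul, mul_one]
    push_cast
    ring
  have hn_err : Real.log n.factorial = stirlingError n +
      (n * Real.log n - n + Real.log n / 2 + Real.log (2 * π) / 2) := by
    rw [stirlingError]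
    ring
  linarith

/-- **Proposition 1 (Non-asymptotic local expansion).** -/
theorem stmt0 (d : ℕ) (τ : ℝ) (hτ : (d : ℝ) + 1 ≤ τ) (n : ℕ) (hn : τ ^ 4 ≤ (n : ℝ))
    (p : Fin d → ℝ) (hp : p ∈ Ptau d τ) (k : Fin d → ℕ) (hk : k ∈ bulk d n τ p) :
    ∃ R : ℝ, logRatio d n p k = mainTerm d n p (castK d k) + R ∧
      |R| ≤ errBound d n τ p (castK d k) := by
  have hτ1 : 1 ≤ τ := by
    have : (0 : ℝ) ≤ d := d.cast_nonneg
    linarith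
  obtain ⟨hps, hpτ⟩ := hp
  obtain ⟨hk0, hkn, hkb⟩ := hk
  have hn0 : 0 < n := (Nat.zero_le _).trans_lt hkn
  have hn' : (0 : ℝ) < n := by exact_mod_cast hn0
  have hs : 0 < √(n : ℝ) := Real.sqrt_pos.2 hn'
  have hss : √(n : ℝ) ^ 2 = n := Real.sq_sqrt hn'.le
  obtain ⟨K, hK⟩ : ∃ K : Fin (d + 1) → ℕ, K = Fin.snoc k (n - ∑ i, k i) := ⟨_, rfl⟩
  have hKpos : ∀ i, 0 < K i := by
    intro i
    rw [hK]
    induction i using Fin.lastCases with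
    | last => simpa using hkn
    | cast i => simpa using hk0 i
  have hext : ∀ i, extV d n (castK d k) i = K i := fun i => by
    rw [hK, cast_snoc_eq_extV hkn.le]
  have hx : ∀ i, ∃ x : ℝ, |x| ≤ 7 / 8 ∧ (K i : ℝ) = n * extP d p i * (1 + x) ∧
      del n (extP d p i) (K i) = √(n : ℝ) * extP d p i * x := by
    intro i
    have hq := extP_pos hps i
    refine ⟨_, (hkb i).trans (mul_sqrt_log_div_le hτ1 hn), ?_, ?_⟩
    · rw [hext, del, div_div, ← mul_assoc, Real.mul_self_sqrt hn'.le]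
      field_simp
      ring
    · rw [hext]
      field_simp
  refine ⟨logRatio d n p k - mainTerm d n p (castK d k), by ring, ?_⟩
  have hrpow : (n : ℝ) ^ (-(1 : ℝ) / 2) = (√(n : ℝ))⁻¹ := by
    rw [neg_div, Real.rpow_neg hn'.le, Real.sqrt_eq_rpow]
  rw [logRatio_eq hps hkn.le hK hKpos hn0, mainTerm, errBound, hrpow]
  simp only [hext]
  have hcell : ∀ i, |-((K i : ℝ) + 1 / 2) * Real.log (K i / (n * extP d p i)) +
        (K i - n * extP d p i) + del n (extP d p i) (K i) ^ 2 / (2 * extP d p i) -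
        (√(n : ℝ))⁻¹ * (del n (extP d p i) (K i) ^ 3 / (6 * extP d p i ^ 2) -
          del n (extP d p i) (K i) / (2 * extP d p i))| ≤
      (n : ℝ)⁻¹ * (21 * |del n (extP d p i) (K i)| ^ 4 / extP d p i ^ 3 +
        10 * |del n (extP d p i) (K i)| ^ 2 / extP d p i ^ 2) := by
    intro i
    obtain ⟨x, hx1, hx2, hx3⟩ := hx i
    have hq := extP_pos hps i
    have h := abs_cell_remainder_le hs hq hx1
    rw [hss] at h
    rw [hx3, hx2, mul_div_cancel_left₀ _ (mul_pos hn' hq).ne',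
      show n * extP d p i * (1 + x) - n * extP d p i = n * extP d p i * x by ring]
    exact h
  have hKerr : ∀ i, stirlingError (K i) ≤ (n : ℝ)⁻¹ * (2 * τ / 3) := by
    intro i
    obtain ⟨x, hx1, hx2, -⟩ := hx i
    have hq := extP_pos hps i
    have hqτ : 1 ≤ τ * extP d p i := (inv_le_iff_one_le_mul₀ hq).1 (hpτ i)
    refine (stirlingError_le (hKpos i).ne').trans ?_
    have hx1' : 1 / 8 ≤ 1 + x := by linarith [(abs_le.1 hx1).1]
    have hKi : (0 : ℝ) < K i := by exact_mod_cast hKpos i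
    rw [inv_mul_eq_div, div_le_div_iff₀ (by positivity) hn', hx2]
    have h1 : (n : ℝ) * (τ * extP d p i) * (1 / 8) ≤ n * (τ * extP d p i) * (1 + x) := by
      gcongr
    nlinarith [mul_le_mul_of_nonneg_left hqτ hn'.le]
  have hnerr : stirlingError n ≤ ∑ _i : Fin (d + 1), (n : ℝ)⁻¹ * (2 * τ / 3) := by
    have h1 : stirlingError n ≤ (n : ℝ)⁻¹ * (2 * τ / 3) := by
      refine (stirlingError_le hn0.ne').trans ?_
      rw [inv_mul_eq_div, div_le_div_iff₀ (by positivity) hn']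
      nlinarith
    exact h1.trans (Finset.single_le_sum
      (f := fun _ : Fin (d + 1) => (n : ℝ)⁻¹ * (2 * τ / 3))
      (fun _ _ => by positivity) (Finset.mem_univ 0))
  have hsum_err := Finset.sum_le_sum fun i (_ : i ∈ Finset.univ) => hKerr i
  have hsum_nonneg : 0 ≤ ∑ i, stirlingError (K i) :=
    Finset.sum_nonneg fun i _ => stirlingError_nonneg (hKpos i).ne'
  have hn_nonneg := stirlingError_nonneg hn0.ne'
  have herr : |stirlingError n - ∑ i, stirlingError (K i)| ≤
      ∑ _i : Fin (d + 1), (n : ℝ)⁻¹ * (2 * τ / 3) := by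
    rw [abs_le]
    constructor <;> linarith
  rw [add_sub_right_comm, Finset.mul_sum, ← Finset.sum_sub_distrib, Finset.mul_sum]
  refine (abs_add_le _ _).trans ((add_le_add ((Finset.abs_sum_le_sum_abs _ _).trans
    (Finset.sum_le_sum fun i _ => hcell i)) herr).trans_eq ?_)
  rw [← Finset.sum_add_distrib]
  refine Finset.sum_congr rfl fun i _ => ?_
  ring
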